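/- arXiv:1709.00335 — 2 statements merged into one kernel-verified Lean document; each statement's English description precedes it below -/
import Mathlib

section
/- For every positive integer n, Σ_{k=0}^{n} (−1)^k C(n,k) C(n+k,k) · k² · H_k^{⟨2⟩} equals (−1)^n (n²(n+1)²/2) (2H_n^{⟨2⟩} − H_{n/2}^{⟨2⟩} − 1/(n(n+1))) if n is even, and (−1)^n (n²(n+1)²/2) (2H_n^{⟨2⟩} − H_{(n−1)/2}^{⟨2⟩} + (2 − 3n − 3n²)/(n²(n+1)²)) if n is odd. -/
open Finset

/-- Harmonic number `H_n = ∑_{k=1}^n 1/k`. -/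
noncomputable def harm (n : ℕ) : ℝ := ∑ k ∈ Finset.range n, 1 / ((k : ℝ) + 1)

/-- Second-order harmonic number `H_n^{⟨2⟩} = ∑_{k=1}^n 1/k²`. -/
noncomputable def harm2 (n : ℕ) : ℝ := ∑ k ∈ Finset.range n, 1 / ((k : ℝ) + 1) ^ 2

/-- The coefficient of `x ^ k` in the Legendre polynomial `P_n(1 - 2x)`. -/
noncomputable def legendreCoeff (n k : ℕ) : ℝ :=
  (-1 : ℝ) ^ k * (n.choose k : ℝ) * ((n + k).choose k : ℝ)

@[simp]
lemma legendreCoeff_zero (n : ℕ) : legendreCoeff n 0 = 1 := by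
  simp [legendreCoeff]

lemma legendreCoeff_eq_zero {n k : ℕ} (h : n < k) : legendreCoeff n k = 0 := by
  simp [legendreCoeff, Nat.choose_eq_zero_of_lt h]

lemma legendreCoeff_succ_right (n k : ℕ) :
    ((k : ℝ) + 1) ^ 2 * legendreCoeff n (k + 1)
      = ((k : ℝ) * (k + 1) - n * (n + 1)) * legendreCoeff n k := by
  rcases lt_or_ge n k with h | h
  · rw [legendreCoeff_eq_zero h, legendreCoeff_eq_zero (by lia)]
    simp
  · have h₁ : (n.choose (k + 1) : ℝ) * (k + 1) = n.choose k * (n - k) := by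
      have := Nat.choose_succ_right_eq n k
      rw [← Nat.cast_sub h]
      exact_mod_cast this
    have h₂ : ((n : ℝ) + k + 1) * ((n + k).choose k) = ((n + (k + 1)).choose (k + 1)) * (k + 1) := by
      exact_mod_cast Nat.add_one_mul_choose_eq (n + k) k
    simp only [legendreCoeff, pow_succ]
    linear_combination (-(-1 : ℝ) ^ k * ((n + (k + 1)).choose (k + 1)) * (k + 1)) * h₁
      + ((-1 : ℝ) ^ k * n.choose k * (n - k)) * h₂

lemma legendreCoeff_succ_left (n k : ℕ) :
    ((n : ℝ) + 1 + k) * legendreCoeff n k = ((n : ℝ) + 1 - k) * legendreCoeff (n + 1) k := by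
  induction k with
  | zero => simp
  | succ k ih =>
    have hk : ((k : ℝ) + 1) ^ 2 ≠ 0 := by positivity
    have h₁ := legendreCoeff_succ_right n k
    have h₂ := legendreCoeff_succ_right (n + 1) k
    apply mul_left_cancel₀ hk
    push_cast at *
    linear_combination ((n : ℝ) + k + 2) * h₁ - ((n : ℝ) - k) * h₂
      + ((n : ℝ) + k + 2) * (k - n) * ih

/-- The telescoping antidifference of `k ↦ legendreCoeff (n + 1) k + legendreCoeff n k`. -/
lemma legendreCoeff_add_eq_sub (n k : ℕ) :
    legendreCoeff (n + 1) k + legendreCoeff n k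
      = -2 / ((n : ℝ) + 1) * (((k + 1 : ℕ) : ℝ) ^ 2 * legendreCoeff (n + 1) (k + 1)
          / ((n : ℝ) + 1 + (k + 1 : ℕ)))
        - -2 / ((n : ℝ) + 1) * ((k : ℝ) ^ 2 * legendreCoeff (n + 1) k / ((n : ℝ) + 1 + k)) := by
  have h₁ := legendreCoeff_succ_right (n + 1) k
  have h₂ := legendreCoeff_succ_left n k
  have hp : (n : ℝ) + 1 + k ≠ 0 := by positivity
  have hq : (n : ℝ) + 1 + (k + 1) ≠ 0 := by positivity
  have hn : (n : ℝ) + 1 ≠ 0 := by positivity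
  push_cast at *
  rw [h₁]
  have h₃ : legendreCoeff n k
      = ((n : ℝ) + 1 - k) * legendreCoeff (n + 1) k / ((n : ℝ) + 1 + k) := by
    rw [eq_div_iff hp, ← h₂]
    ring
  rw [h₃]
  field_simp
  ring

lemma harm2_succ (n : ℕ) : harm2 (n + 1) = harm2 n + 1 / ((n : ℝ) + 1) ^ 2 :=
  Finset.sum_range_succ _ _

lemma sum_sub_mul_harm2 (c : ℕ → ℝ) (m : ℕ) :
    ∑ k ∈ Finset.range m, (c (k + 1) - c k) * harm2 k
      = c m * harm2 m - ∑ k ∈ Finset.range m, c (k + 1) / ((k : ℝ) + 1) ^ 2 := by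
  induction m with
  | zero => simp [harm2]
  | succ m ih =>
    rw [Finset.sum_range_succ, Finset.sum_range_succ, ih, harm2_succ]
    ring

lemma sum_legendreCoeff_mul_succ (n : ℕ) (f : ℕ → ℝ) :
    ∑ k ∈ Finset.range (n + 2), legendreCoeff n k * f k
      = ∑ k ∈ Finset.range (n + 1), legendreCoeff n k * f k := by
  rw [Finset.sum_range_succ _ (n + 1), legendreCoeff_eq_zero (Nat.lt_succ_self n)]
  simp

lemma sum_legendreCoeff_add (n : ℕ) :
    ∑ k ∈ Finset.range (n + 2), (legendreCoeff (n + 1) k + legendreCoeff n k) = 0 := by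
  rw [Finset.sum_congr rfl fun k _ => legendreCoeff_add_eq_sub n k,
    Finset.sum_range_sub fun k : ℕ =>
      -2 / ((n : ℝ) + 1) * ((k : ℝ) ^ 2 * legendreCoeff (n + 1) k / ((n : ℝ) + 1 + k)),
    legendreCoeff_eq_zero (Nat.lt_succ_self (n + 1))]
  simp

lemma sum_legendreCoeff (n : ℕ) :
    ∑ k ∈ Finset.range (n + 1), legendreCoeff n k = (-1) ^ n := by
  induction n with
  | zero => simp
  | succ n ih =>
    have h := sum_legendreCoeff_add n
    have h' := sum_legendreCoeff_mul_succ n fun _ => 1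
    simp only [mul_one] at h'
    rw [Finset.sum_add_distrib, h', ih] at h
    rw [pow_succ]
    linarith

lemma sum_legendreCoeff_mul_self (n : ℕ) :
    ∑ k ∈ Finset.range (n + 1), legendreCoeff n k * k = (n : ℝ) * (n + 1) * (-1) ^ n := by
  have h : ∑ k ∈ Finset.range (n + 1),
      (legendreCoeff n k * k - (n : ℝ) * (n + 1) * legendreCoeff n k) = 0 := by
    have hk : ∀ k ∈ Finset.range (n + 1),
        legendreCoeff n k * k - (n : ℝ) * (n + 1) * legendreCoeff n k
          = ((k + 1 : ℕ) : ℝ) ^ 2 * legendreCoeff n (k + 1) - (k : ℝ) ^ 2 * legendreCoeff n k := by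
      intro k _
      have := legendreCoeff_succ_right n k
      push_cast
      rw [this]
      ring
    rw [Finset.sum_congr rfl hk,
      Finset.sum_range_sub fun k : ℕ => (k : ℝ) ^ 2 * legendreCoeff n k,
      legendreCoeff_eq_zero (Nat.lt_succ_self n)]
    simp
  rw [Finset.sum_sub_distrib, ← Finset.mul_sum, sum_legendreCoeff] at h
  linarith

lemma sum_legendreCoeff_add_mul_harm2 (n : ℕ) :
    ∑ k ∈ Finset.range (n + 2), (legendreCoeff (n + 1) k + legendreCoeff n k) * harm2 k
      = -2 / ((n : ℝ) + 1) ^ 2 := by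
  have hn : (n : ℝ) + 1 ≠ 0 := by positivity
  rw [Finset.sum_congr rfl fun k _ => congrArg (· * harm2 k) (legendreCoeff_add_eq_sub n k),
    sum_sub_mul_harm2 fun k : ℕ =>
      -2 / ((n : ℝ) + 1) * ((k : ℝ) ^ 2 * legendreCoeff (n + 1) k / ((n : ℝ) + 1 + k)),
    legendreCoeff_eq_zero (Nat.lt_succ_self (n + 1))]
  have hk : ∀ k ∈ Finset.range (n + 2),
      -2 / ((n : ℝ) + 1) * (((k + 1 : ℕ) : ℝ) ^ 2 * legendreCoeff (n + 1) (k + 1)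
        / ((n : ℝ) + 1 + (k + 1 : ℕ))) / ((k : ℝ) + 1) ^ 2
      = -1 / ((n : ℝ) + 1) ^ 2 * (legendreCoeff (n + 1) (k + 1) + legendreCoeff n (k + 1)) := by
    intro k _
    have h₂ := legendreCoeff_succ_left n (k + 1)
    have hp : (n : ℝ) + 1 + (k + 1) ≠ 0 := by positivity
    have hk : (k : ℝ) + 1 ≠ 0 := by positivity
    push_cast at *
    have h₃ : legendreCoeff n (k + 1)
        = ((n : ℝ) + 1 - (k + 1)) * legendreCoeff (n + 1) (k + 1) / ((n : ℝ) + 1 + (k + 1)) := by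
      rw [eq_div_iff hp, ← h₂]
      ring
    rw [h₃]
    field_simp
    ring
  have hs := Finset.sum_range_succ' (fun k => legendreCoeff (n + 1) k + legendreCoeff n k) (n + 2)
  rw [Finset.sum_range_succ, sum_legendreCoeff_add, legendreCoeff_eq_zero (by lia),
    legendreCoeff_eq_zero (by lia), legendreCoeff_zero, legendreCoeff_zero] at hs
  rw [Finset.sum_congr rfl hk, ← Finset.mul_sum]
  have hs' : ∑ k ∈ Finset.range (n + 2),
      (legendreCoeff (n + 1) (k + 1) + legendreCoeff n (k + 1)) = -2 := by linarith
  rw [hs']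
  simp only [mul_zero, zero_div, zero_mul]
  ring

lemma sum_legendreCoeff_mul_harm2 (n : ℕ) :
    ∑ k ∈ Finset.range (n + 1), legendreCoeff n k * harm2 k
      = (-1) ^ n * (2 * harm2 n - harm2 (n / 2)) := by
  induction n with
  | zero => simp [harm2]
  | succ n ih =>
    have h := sum_legendreCoeff_add_mul_harm2 n
    simp only [add_mul, Finset.sum_add_distrib] at h
    rw [sum_legendreCoeff_mul_succ n harm2, ih] at h
    rw [eq_sub_of_add_eq h, harm2_succ]
    rcases Nat.even_or_odd' n with ⟨m, rfl | rfl⟩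
    · rw [show (2 * m + 1) / 2 = m by lia, show 2 * m / 2 = m by lia, pow_succ (-1 : ℝ),
        (even_two_mul m).neg_one_pow]
      ring
    · rw [show (2 * m + 1 + 1) / 2 = m + 1 by lia, show (2 * m + 1) / 2 = m by lia, harm2_succ m,
        pow_succ (-1 : ℝ) (2 * m + 1), pow_succ (-1 : ℝ) (2 * m), (even_two_mul m).neg_one_pow]
      have hm : (m : ℝ) + 1 ≠ 0 := by positivity
      push_cast
      rw [show (2 * (m : ℝ) + 1 + 1) = 2 * (m + 1) by ring]
      field_simp
      ring

lemma sum_legendreCoeff_mul_sq_mul_harm2 (n : ℕ) :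
    2 * ∑ k ∈ Finset.range (n + 1), legendreCoeff n k * (k : ℝ) ^ 2 * harm2 k
      = ((n : ℝ) * (n + 1)) ^ 2 * ((-1) ^ n * (2 * harm2 n - harm2 (n / 2)))
        - (2 * ((n : ℝ) * (n + 1)) - 1) * (-1) ^ n + (n : ℝ) * (n + 1) - 1 := by
  have hc := sum_sub_mul_harm2
    (fun k : ℕ => ((k : ℝ) - 1 + n * (n + 1)) * ((k : ℝ) ^ 2 * legendreCoeff n k)) (n + 1)
  have hl : ∀ k ∈ Finset.range (n + 1),
      ((((k + 1 : ℕ) : ℝ) - 1 + n * (n + 1)) * (((k + 1 : ℕ) : ℝ) ^ 2 * legendreCoeff n (k + 1))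
        - ((k : ℝ) - 1 + n * (n + 1)) * ((k : ℝ) ^ 2 * legendreCoeff n k)) * harm2 k
      = 2 * (legendreCoeff n k * (k : ℝ) ^ 2 * harm2 k)
        - ((n : ℝ) * (n + 1)) ^ 2 * (legendreCoeff n k * harm2 k) := by
    intro k _
    have := legendreCoeff_succ_right n k
    push_cast
    rw [this]
    ring
  have hr : ∀ k ∈ Finset.range (n + 1),
      (((k + 1 : ℕ) : ℝ) - 1 + n * (n + 1)) * (((k + 1 : ℕ) : ℝ) ^ 2 * legendreCoeff n (k + 1))
        / ((k : ℝ) + 1) ^ 2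
      = legendreCoeff n (k + 1) * (((k + 1 : ℕ) : ℝ) - 1 + n * (n + 1)) := by
    intro k _
    have hk : (k : ℝ) + 1 ≠ 0 := by positivity
    push_cast
    field_simp
  have hs := Finset.sum_range_succ'
    (fun k : ℕ => legendreCoeff n k * ((k : ℝ) - 1 + n * (n + 1))) (n + 1)
  have ht : ∑ k ∈ Finset.range (n + 1), legendreCoeff n k * ((k : ℝ) - 1 + n * (n + 1))
      = (2 * ((n : ℝ) * (n + 1)) - 1) * (-1) ^ n := by
    have hk : ∀ k ∈ Finset.range (n + 1), legendreCoeff n k * ((k : ℝ) - 1 + n * (n + 1))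
        = legendreCoeff n k * k + ((n : ℝ) * (n + 1) - 1) * legendreCoeff n k := by
      intro k _
      ring
    rw [Finset.sum_congr rfl hk, Finset.sum_add_distrib, ← Finset.mul_sum, sum_legendreCoeff,
      sum_legendreCoeff_mul_self]
    ring
  rw [sum_legendreCoeff_mul_succ n fun k : ℕ => (k : ℝ) - 1 + n * (n + 1), ht,
    legendreCoeff_zero] at hs
  rw [Finset.sum_congr rfl hl, Finset.sum_congr rfl hr, Finset.sum_sub_distrib, ← Finset.mul_sum,
    ← Finset.mul_sum, sum_legendreCoeff_mul_harm2, legendreCoeff_eq_zero (Nat.lt_succ_self n)] at hc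
  push_cast at hc hs
  linarith

theorem stmt15 (n : ℕ) (hn : 0 < n) :
    ∑ k ∈ Finset.range (n + 1),
      (-1 : ℝ) ^ k * (n.choose k : ℝ) * ((n + k).choose k : ℝ) * (k : ℝ) ^ 2 * harm2 k
    = if n % 2 = 0 then
        (-1 : ℝ) ^ n * ((n : ℝ) ^ 2 * ((n : ℝ) + 1) ^ 2 / 2) *
          (2 * harm2 n - harm2 (n / 2) - 1 / ((n : ℝ) * ((n : ℝ) + 1)))
      else
        (-1 : ℝ) ^ n * ((n : ℝ) ^ 2 * ((n : ℝ) + 1) ^ 2 / 2) *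
          (2 * harm2 n - harm2 ((n - 1) / 2)
            + (2 - 3 * (n : ℝ) - 3 * (n : ℝ) ^ 2) / ((n : ℝ) ^ 2 * ((n : ℝ) + 1) ^ 2)) := by
  have h := sum_legendreCoeff_mul_sq_mul_harm2 n
  have hn' : (n : ℝ) ≠ 0 := by positivity
  have hn₁ : (n : ℝ) + 1 ≠ 0 := by positivity
  simp only [legendreCoeff] at h
  split_ifs with hp
  · rw [(Nat.even_iff.mpr hp).neg_one_pow] at h ⊢
    field_simp
    linear_combination h
  · have ho : Odd n := Nat.odd_iff.mpr (by lia)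
    rw [show n / 2 = (n - 1) / 2 by lia, ho.neg_one_pow] at h
    rw [ho.neg_one_pow]
    field_simp
    linear_combination h
end

section
/- For every integer n ≥ 2, Σ_{k=0}^{n} (−1)^k C(n,k) · k · H_{n+k}² = ((n+1)/(n−1)) · (1/C(2n,n)) · (H_{2n} − H_n + (5n² + n − 2)/(n³ − n)). -/
open Finset

lemma harm_succ (n : ℕ) : harm (n + 1) = harm n + 1 / ((n : ℝ) + 1) :=
  Finset.sum_range_succ _ _

lemma sum_alternating_choose_succ (n : ℕ) (f : ℕ → ℝ) :
    ∑ k ∈ Finset.range (n + 2), (-1 : ℝ) ^ k * ((n + 1).choose k : ℝ) * f k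
    = ∑ k ∈ Finset.range (n + 1), (-1 : ℝ) ^ k * (n.choose k : ℝ) * f k
      - ∑ k ∈ Finset.range (n + 1), (-1 : ℝ) ^ k * (n.choose k : ℝ) * f (k + 1) := by
  have h : ∑ k ∈ Finset.range (n + 1), (-1 : ℝ) ^ k * (n.choose k : ℝ) * f k
      = ∑ k ∈ Finset.range (n + 2), (-1 : ℝ) ^ k * (n.choose k : ℝ) * f k := by
    simp [Finset.sum_range_succ _ (n + 1)]
  rw [h, Finset.sum_range_succ', Finset.sum_range_succ' _ (n + 1), add_sub_right_comm,
    ← Finset.sum_sub_distrib]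
  congr 1
  · refine Finset.sum_congr rfl fun k _ => ?_
    rw [Nat.choose_succ_succ']
    push_cast
    ring
  · simp

/-- The higher differences of the squared harmonic numbers in closed form. -/
lemma sum_alternating_choose_harm_sq (n m : ℕ) :
    ∑ k ∈ Finset.range (n + 2), (-1 : ℝ) ^ k * ((n + 1).choose k : ℝ) * harm (m + k) ^ 2
    = -((n.factorial : ℝ) * (m.factorial : ℝ) / ((m + n + 1).factorial : ℝ))
      * (harm m + harm (m + n + 1) - 2 * harm n) := by
  induction n generalizing m with
  | zero =>
    have hm : (m.factorial : ℝ) ≠ 0 := by positivity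
    simp [Finset.sum_range_succ, harm_succ, Nat.factorial_succ, show harm 0 = 0 by simp [harm]]
    field_simp
    ring
  | succ n ih =>
    have hs := ih (m + 1)
    have e : ∀ k, m + 1 + k = m + (k + 1) := fun k => by ring
    simp only [e] at hs
    rw [sum_alternating_choose_succ, ih, hs]
    have e1 : m + (n + 1) + 1 = m + n + 1 + 1 := by ring
    rw [e1, harm_succ (m + n + 1), harm_succ m, harm_succ n,
      Nat.factorial_succ (m + n + 1), Nat.factorial_succ m, Nat.factorial_succ n]
    have hF : ((m + n + 1).factorial : ℝ) ≠ 0 := by positivity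
    push_cast
    have h1 : (m : ℝ) + n + 1 + 1 ≠ 0 := by positivity
    have h2 : (m : ℝ) + 1 ≠ 0 := by positivity
    have h3 : (n : ℝ) + 1 ≠ 0 := by positivity
    field_simp
    ring

lemma sum_choose_mul_self (n : ℕ) (f : ℕ → ℝ) :
    ∑ k ∈ Finset.range (n + 2), (-1 : ℝ) ^ k * ((n + 1).choose k : ℝ) * (k : ℝ) * f k
    = -((n : ℝ) + 1) *
      ∑ k ∈ Finset.range (n + 1), (-1 : ℝ) ^ k * (n.choose k : ℝ) * f (k + 1) := by
  rw [Finset.sum_range_succ', Finset.mul_sum]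
  simp only [Nat.cast_zero, mul_zero, zero_mul, add_zero]
  refine Finset.sum_congr rfl fun k _ => ?_
  have h : ((n : ℝ) + 1) * (n.choose k : ℝ) = ((n + 1).choose (k + 1) : ℝ) * ((k : ℝ) + 1) := by
    exact_mod_cast Nat.add_one_mul_choose_eq n k
  push_cast
  linear_combination (-1 : ℝ) ^ k * f (k + 1) * h

theorem stmt19 (n : ℕ) (hn : 2 ≤ n) :
    ∑ k ∈ Finset.range (n + 1), (-1 : ℝ) ^ k * (n.choose k : ℝ) * (k : ℝ) * (harm (n + k)) ^ 2
    = (((n : ℝ) + 1) / ((n : ℝ) - 1)) * (1 / ((2 * n).choose n : ℝ)) *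
        (harm (2 * n) - harm n + (5 * (n : ℝ) ^ 2 + (n : ℝ) - 2) / ((n : ℝ) ^ 3 - (n : ℝ))) := by
  obtain ⟨p, rfl⟩ := Nat.exists_eq_add_of_le' hn
  have hc : ((2 * (p + 2)).choose (p + 2) : ℝ)
      = ((2 * (p + 2)).factorial : ℝ) / ((p + 2).factorial * (p + 2).factorial) := by
    rw [Nat.cast_choose ℝ (by omega), show 2 * (p + 2) - (p + 2) = p + 2 by omega]
  have hs := sum_alternating_choose_harm_sq p (p + 2 + 1)
  have e : ∀ k, p + 2 + 1 + k = p + 2 + (k + 1) := fun k => by ring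
  simp only [e] at hs
  rw [sum_choose_mul_self (p + 1) fun k => harm (p + 2 + k) ^ 2, hs, hc,
    show p + 2 + (p + 1) + 1 = 2 * (p + 2) by ring, harm_succ (p + 2), harm_succ (p + 1),
    harm_succ p, Nat.factorial_succ (p + 2), Nat.factorial_succ (p + 1), Nat.factorial_succ p]
  have hF : ((2 * (p + 2)).factorial : ℝ) ≠ 0 := by positivity
  have hp : (p.factorial : ℝ) ≠ 0 := by positivity
  push_cast
  have h1 : (p : ℝ) + 2 - 1 = p + 1 := by ring
  have h2 : ((p : ℝ) + 2) ^ 3 - (p + 2) = (p + 1) * (p + 2) * (p + 3) := by ring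
  have h3 : (p : ℝ) + 1 + 1 = p + 2 := by ring
  have h4 : (p : ℝ) + 2 + 1 = p + 3 := by ring
  rw [h1, h2, h3, h4]
  field_simp
  ring
end
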